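/- Let T be a finite index type, N a positive semidefinite T×T complex matrix, m a natural number, wt : T → (Fin m → ℕ) a weight assignment, and w : Fin m → ℕ. Suppose that for every α : Fin m → ℂ with |α_i| = 1 for all i, Σ_{t∈T} (∏_i α_i^{wt(t)_i}) · N_{t,t} = (∏_i α_i^{w_i}) · Σ_{t∈T} N_{t,t}. Then N_{t,t'} = 0 whenever wt(t) ≠ w or wt(t') ≠ w; that is, N is supported on the weight-w subspace. (This is the key step in the lemma that for a state with definite site occupations ξ(i), the visible part Tr_H(M|_λ) is supported in the weight space (𝕊_λ(H_V))_{wt=ξ(i)}.) -/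

import Mathlib

open scoped BigOperators ComplexOrder

/-- A positive semidefinite matrix with a vanishing diagonal entry vanishes on that row. -/
theorem Matrix.PosSemidef.apply_eq_zero_of_diag_eq_zero {T : Type*} [Fintype T]
    {N : Matrix T T ℂ} (hN : N.PosSemidef) {s : T} (hs : N s s = 0) (t : T) : N s t = 0 := by
  have hdet := (hN.submatrix ![s, t]).det_nonneg
  simp only [Matrix.det_fin_two, Matrix.submatrix_apply, Matrix.cons_val_zero,
    Matrix.cons_val_one, hs, zero_mul, zero_sub] at hdet
  rw [← hN.isHermitian.apply t s, Complex.star_def, Complex.mul_conj] at hdet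
  have hle : Complex.normSq (N s t) ≤ 0 := by
    have := (Complex.le_def.mp hdet).1
    simpa using this
  exact Complex.normSq_eq_zero.mp (le_antisymm hle (Complex.normSq_nonneg _))

/-- If a combination of unit complex numbers with nonnegative coefficients equals a unit `u` times
the sum of the coefficients, then every unit with nonzero coefficient equals `u`. -/
theorem Complex.eq_of_sum_mul_eq_mul_sum {T : Type*} [Fintype T] {c z : T → ℂ} {u : ℂ}
    (hc : ∀ t, 0 ≤ c t) (hz : ∀ t, ‖z t‖ = 1) (hu : ‖u‖ = 1)
    (h : ∑ t, z t * c t = u * ∑ t, c t) {t : T} (ht : c t ≠ 0) : z t = u := by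
  have hconj : star u * u = 1 := by
    rw [Complex.star_def, Complex.conj_mul', hu]; simp
  have hnorm (s : T) : ‖star u * z s‖ = 1 := by simp [hz, hu]
  have hsum : ∑ s, (1 - (star u * z s).re) * (c s).re = 0 := by
    have key : ∑ s, (1 - star u * z s) * c s = 0 := by
      simp only [sub_mul, one_mul, mul_assoc, Finset.sum_sub_distrib, ← Finset.mul_sum, h]
      rw [← mul_assoc, hconj, one_mul, sub_self]
    have hre := congrArg Complex.re key
    rw [Complex.re_sum, Complex.zero_re] at hre
    rw [← hre]
    refine Finset.sum_congr rfl fun s _ => ?_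
    have him : (c s).im = 0 := ((Complex.le_def.mp (hc s)).2).symm
    rw [Complex.mul_re (1 - _), him, mul_zero, sub_zero, Complex.sub_re, Complex.one_re]
  have hterm := (Finset.sum_eq_zero_iff_of_nonneg fun s _ => mul_nonneg
    (sub_nonneg.mpr ((Complex.re_le_norm _).trans_eq (hnorm s)))
    (Complex.le_def.mp (hc s)).1).mp hsum t (Finset.mem_univ t)
  have hct : (c t).re ≠ 0 := fun h0 =>
    ht (Complex.ext h0 (Complex.le_def.mp (hc t)).2.symm)
  have hre : (star u * z t).re = ‖star u * z t‖ := by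
    rw [hnorm]
    linarith [(mul_eq_zero.mp hterm).resolve_right hct]
  have hone : star u * z t = 1 := by
    rw [Complex.eq_coe_norm_of_nonneg (Complex.re_eq_norm.mp hre), hnorm, Complex.ofReal_one]
  calc z t = (star u * u) * z t := by rw [hconj, one_mul]
    _ = u * (star u * z t) := by ring
    _ = u := by rw [hone, mul_one]

/-- If the diagonal of `N` has total weight `w`, its entries at indices of other weights vanish. -/
theorem Matrix.PosSemidef.diag_eq_zero_of_weight_ne {T : Type*} [Fintype T] {m : ℕ}
    {N : Matrix T T ℂ} (hN : N.PosSemidef) {wt : T → (Fin m → ℕ)} {w : Fin m → ℕ}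
    (h : ∀ α : Fin m → ℂ, (∀ i, ‖α i‖ = 1) →
      ∑ t, (∏ i, α i ^ wt t i) * N t t = (∏ i, α i ^ w i) * ∑ t, N t t)
    {t : T} (ht : wt t ≠ w) : N t t = 0 := by
  obtain ⟨i, hi⟩ := Function.ne_iff.mp ht
  by_contra hne
  have hζ := Complex.isPrimitiveRoot_exp (wt t i + w i + 1) (Nat.succ_ne_zero _)
  generalize Complex.exp _ = ζ at hζ
  have hζ1 : ‖ζ‖ = 1 := hζ.norm'_eq_one (Nat.succ_ne_zero _)
  have hprod (a : Fin m → ℕ) : ∏ j, (Pi.mulSingle i ζ : Fin m → ℂ) j ^ a j = ζ ^ a i := by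
    rw [Finset.prod_eq_single i (fun j _ hj => by simp [Pi.mulSingle_eq_of_ne hj]) (by simp),
      Pi.mulSingle_eq_same]
  have hα := h (Pi.mulSingle i ζ) fun j => by
    by_cases hj : j = i
    · subst hj; simpa using hζ1
    · simp [Pi.mulSingle_eq_of_ne hj]
  simp only [hprod] at hα
  have heq := Complex.eq_of_sum_mul_eq_mul_sum (fun s => hN.diag_nonneg)
    (fun s => by simp [hζ1]) (by simp [hζ1]) hα hne
  exact hi (hζ.pow_inj (by omega) (by omega) heq)

/-- If the diagonal of a positive semidefinite matrix `N`, indexed by vectors of weight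
`wt t`, transforms with total weight `w` under every diagonal torus element
`α ∈ U(1)^m`, then `N` is supported on the weight-`w` subspace: `N t t' = 0` whenever
`wt t ≠ w` or `wt t' ≠ w`. -/
theorem stmt15 {T : Type*} [Fintype T] {m : ℕ} (N : Matrix T T ℂ) (hN : N.PosSemidef)
    (wt : T → (Fin m → ℕ)) (w : Fin m → ℕ)
    (h : ∀ α : Fin m → ℂ, (∀ i, ‖α i‖ = 1) →
      ∑ t, (∏ i, α i ^ wt t i) * N t t = (∏ i, α i ^ w i) * ∑ t, N t t)
    (t t' : T) (h' : wt t ≠ w ∨ wt t' ≠ w) : N t t' = 0 := by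
  rcases h' with ht | ht
  · exact hN.apply_eq_zero_of_diag_eq_zero (hN.diag_eq_zero_of_weight_ne h ht) t'
  · rw [← hN.isHermitian.apply t t',
      hN.apply_eq_zero_of_diag_eq_zero (hN.diag_eq_zero_of_weight_ne h ht) t, star_zero]
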